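/- Let (Ω, P) be a probability space, E a real inner product space (e.g. Euclidean space ℝ^d), f : E → ℝ differentiable and μ-strongly convex with μ > 0 and global minimizer x*, σ ≥ 0, and γ ∈ (0, 1/μ). Let (F_j) be a filtration on Ω, let G_j : Ω → E be random vectors with G_j measurable with respect to F_{j+1}, and define iterates x_0 ∈ E (deterministic) and x_{j+1} = x_j − γ·G_j, so that each x_j is F_j-measurable. Assume for each j that, almost surely, the conditional expectation E[G_j | F_j] = ∇f(x_j) and E[‖G_j‖² | F_j] ≤ σ². Then for every j, E[‖x_j − x*‖²] ≤ (1 − γμ)^j · ‖x_0 − x*‖² + γσ²/μ. -/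

import Mathlib

open MeasureTheory ProbabilityTheory RealInnerProductSpace

section Helpers

variable {E : Type*} [NormedAddCommGroup E] [InnerProductSpace ℝ E]

theorem mul_sq_norm_sub_le_inner_of_isMin [CompleteSpace E] {f : E → ℝ} {f' : E → E} {μ : ℝ}
    (hsc : ∀ x y : E, f y ≥ f x + ⟪f' x, y - x⟫ + μ / 2 * ‖y - x‖ ^ 2) {a : E}
    (hdiff : HasGradientAt f (f' a) a) (hmin : ∀ x, f a ≤ f x) (x : E) :
    μ * ‖x - a‖ ^ 2 ≤ ⟪x - a, f' x⟫ := by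
  have hzero : f' a = 0 := by
    have hloc : IsLocalMin f a := Filter.Eventually.of_forall hmin
    simpa using hloc.hasFDerivAt_eq_zero hdiff.hasFDerivAt
  have h1 := hsc a x
  have h2 := hsc x a
  rw [hzero, inner_zero_left] at h1
  rw [← neg_sub x a, inner_neg_right, norm_neg, real_inner_comm] at h2
  linarith

variable {Ω : Type*} {m m0 : MeasurableSpace Ω} {P : Measure Ω}

theorem integrable_inner_of_memLp_two {u v : Ω → E} (hu : MemLp u 2 P) (hv : MemLp v 2 P) :
    Integrable (fun ω => ⟪u ω, v ω⟫) P :=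
  (hu.norm.integrable_mul hv.norm).mono' (hu.1.inner hv.1)
    (Filter.Eventually.of_forall fun ω => norm_inner_le_norm (u ω) (v ω))

theorem condExp_inner_of_stronglyMeasurable_left [CompleteSpace E] {u v : Ω → E}
    (hum : StronglyMeasurable[m] u) (huv : Integrable (fun ω => ⟪u ω, v ω⟫) P)
    (hv : Integrable v P) :
    P[fun ω => ⟪u ω, v ω⟫ | m] =ᵐ[P] fun ω => ⟪u ω, (P[v | m]) ω⟫ :=
  condExp_bilin_of_stronglyMeasurable_left (innerSL ℝ) hum huv hv

theorem integral_sq_norm_sub_smul {u v : Ω → E} (hu : MemLp u 2 P) (hv : MemLp v 2 P) (γ : ℝ) :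
    ∫ ω, ‖u ω - γ • v ω‖ ^ 2 ∂P =
      ∫ ω, ‖u ω‖ ^ 2 ∂P - 2 * γ * ∫ ω, ⟪u ω, v ω⟫ ∂P + γ ^ 2 * ∫ ω, ‖v ω‖ ^ 2 ∂P := by
  have hu2 := (memLp_two_iff_integrable_sq_norm hu.1).1 hu
  have hv2 := (memLp_two_iff_integrable_sq_norm hv.1).1 hv
  have huv := integrable_inner_of_memLp_two hu hv
  rw [← integral_const_mul, ← integral_const_mul, ← integral_sub hu2 (huv.const_mul _),
    ← integral_add (by exact hu2.sub (huv.const_mul _)) (hv2.const_mul _)]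
  congr 1 with ω
  rw [norm_sub_sq_real, inner_smul_right, norm_smul, mul_pow, Real.norm_eq_abs, sq_abs]
  ring

/-- One stochastic gradient step contracts the mean squared distance, up to the noise. -/
theorem integral_sq_norm_sub_smul_le [CompleteSpace E] [IsProbabilityMeasure P] (hm : m ≤ m0)
    {u v : Ω → E} (hum : StronglyMeasurable[m] u) (hu : MemLp u 2 P) (hv : MemLp v 2 P)
    {μ σ γ : ℝ} (hγ : 0 ≤ γ)
    (hdrift : ∀ᵐ ω ∂P, μ * ‖u ω‖ ^ 2 ≤ ⟪u ω, (P[v | m]) ω⟫)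
    (hnoise : ∀ᵐ ω ∂P, (P[fun ω' => ‖v ω'‖ ^ 2 | m]) ω ≤ σ ^ 2) :
    ∫ ω, ‖u ω - γ • v ω‖ ^ 2 ∂P ≤
      (1 - 2 * γ * μ) * ∫ ω, ‖u ω‖ ^ 2 ∂P + γ ^ 2 * σ ^ 2 := by
  have hu2 := (memLp_two_iff_integrable_sq_norm hu.1).1 hu
  have huv := integrable_inner_of_memLp_two hu hv
  have hcross : μ * ∫ ω, ‖u ω‖ ^ 2 ∂P ≤ ∫ ω, ⟪u ω, v ω⟫ ∂P := by
    rw [← integral_condExp hm (f := fun ω => ⟪u ω, v ω⟫), ← integral_const_mul]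
    refine integral_mono_ae (hu2.const_mul _) integrable_condExp ?_
    filter_upwards [hdrift, condExp_inner_of_stronglyMeasurable_left hum huv
      (hv.integrable one_le_two)] with ω h1 h2
    rwa [h2]
  have hsecond : ∫ ω, ‖v ω‖ ^ 2 ∂P ≤ σ ^ 2 := by
    rw [← integral_condExp hm (f := fun ω => ‖v ω‖ ^ 2)]
    simpa using integral_mono_ae integrable_condExp (integrable_const (σ ^ 2)) hnoise
  rw [integral_sq_norm_sub_smul hu hv]
  have h1 := mul_le_mul_of_nonneg_left hcross hγ
  have h2 := mul_le_mul_of_nonneg_left hsecond (sq_nonneg γ)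
  linarith

end Helpers

/-- Theorem 1 of the DBS paper: for SGD iterates `x_{j+1} = x_j − γ·G_j` on a
differentiable `μ`-strongly convex objective `f` with global minimizer `x*`,
where each stochastic gradient `G_j` is conditionally unbiased for `∇f(x_j)`
and has conditional second moment at most `σ²`, and the step size satisfies
`γ ∈ (0, 1/μ)`, one has
`E[‖x_j − x*‖²] ≤ (1 − γμ)^j ‖x_0 − x*‖² + γσ²/μ` for every `j`. -/
theorem dbs_sgd_convergence
    {Ω : Type*} [MeasureSpace Ω] [IsProbabilityMeasure (ℙ : Measure Ω)]
    {E : Type*} [NormedAddCommGroup E] [InnerProductSpace ℝ E] [CompleteSpace E]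
    (f : E → ℝ) (f' : E → E) (μ σ γ : ℝ) (hμ : 0 < μ) (hσ : 0 ≤ σ)
    (hγ0 : 0 < γ) (hγ1 : γ < 1 / μ)
    (hdiff : ∀ x, HasGradientAt f (f' x) x)
    (hsc : ∀ x y : E, f y ≥ f x + ⟪f' x, y - x⟫ + μ / 2 * ‖y - x‖ ^ 2)
    (xstar : E) (hmin : ∀ x, f xstar ≤ f x)
    (ℱ : Filtration ℕ (inferInstance : MeasurableSpace Ω))
    (G : ℕ → Ω → E)
    (hGmeas : ∀ j, StronglyMeasurable[ℱ (j + 1)] (G j))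
    (hGint : ∀ j, Integrable (G j))
    (hG2int : ∀ j, Integrable (fun ω => ‖G j ω‖ ^ 2))
    (x0 : E) (x : ℕ → Ω → E)
    (hx0 : x 0 = fun _ => x0)
    (hxrec : ∀ j, x (j + 1) = fun ω => x j ω - γ • G j ω)
    (hcond : ∀ j, (ℙ[G j | ℱ j]) =ᵐ[ℙ] fun ω => f' (x j ω))
    (hnoise : ∀ j, ∀ᵐ ω ∂ℙ, (ℙ[fun ω' => ‖G j ω'‖ ^ 2 | ℱ j]) ω ≤ σ ^ 2) :
    ∀ j, (∫ ω, ‖x j ω - xstar‖ ^ 2) ≤ (1 - γ * μ) ^ j * ‖x0 - xstar‖ ^ 2 + γ * σ ^ 2 / μ := by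
  have hγμ : γ * μ < 1 := (lt_div_iff₀ hμ).1 hγ1
  have hG : ∀ j, MemLp (G j) 2 := fun j =>
    (memLp_two_iff_integrable_sq_norm (hGint j).1).2 (hG2int j)
  have hxmeas : ∀ j, StronglyMeasurable[ℱ j] (x j) := by
    intro j
    induction j with
    | zero => rw [hx0]; exact stronglyMeasurable_const
    | succ j ih =>
      rw [hxrec]
      exact (ih.mono (ℱ.mono j.le_succ)).sub ((hGmeas j).const_smul γ)
  have hxL : ∀ j, MemLp (x j) 2 := by
    intro j
    induction j with
    | zero => rw [hx0]; exact memLp_const x0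
    | succ j ih => rw [hxrec]; exact ih.sub ((hG j).const_smul γ)
  intro j
  induction j with
  | zero =>
    have : 0 ≤ γ * σ ^ 2 / μ := by positivity
    simpa [hx0] using this
  | succ j ih =>
    have hstep := integral_sq_norm_sub_smul_le (P := ℙ) (ℱ.le j) (u := fun ω => x j ω - xstar)
      (μ := μ) (σ := σ) ((hxmeas j).sub stronglyMeasurable_const)
      ((hxL j).sub (memLp_const xstar)) (hG j) hγ0.le
      (by
        filter_upwards [hcond j] with ω hω
        rw [hω]
        exact mul_sq_norm_sub_le_inner_of_isMin hsc (hdiff xstar) hmin (x j ω))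
      (hnoise j)
    have hnonneg : 0 ≤ ∫ ω, ‖x j ω - xstar‖ ^ 2 := integral_nonneg fun ω => by positivity
    calc ∫ ω, ‖x (j + 1) ω - xstar‖ ^ 2
        = ∫ ω, ‖x j ω - xstar - γ • G j ω‖ ^ 2 := by simp only [hxrec, sub_right_comm]
      _ ≤ (1 - 2 * γ * μ) * (∫ ω, ‖x j ω - xstar‖ ^ 2) + γ ^ 2 * σ ^ 2 := hstep
      _ ≤ (1 - γ * μ) * (∫ ω, ‖x j ω - xstar‖ ^ 2) + γ ^ 2 * σ ^ 2 := by
        nlinarith [mul_nonneg (mul_pos hγ0 hμ).le hnonneg]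
      _ ≤ (1 - γ * μ) * ((1 - γ * μ) ^ j * ‖x0 - xstar‖ ^ 2 + γ * σ ^ 2 / μ)
          + γ ^ 2 * σ ^ 2 := by
        have := mul_le_mul_of_nonneg_left ih (sub_nonneg.2 hγμ.le)
        linarith
      _ = (1 - γ * μ) ^ (j + 1) * ‖x0 - xstar‖ ^ 2 + γ * σ ^ 2 / μ := by
        field_simp
        ring
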